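/- arXiv:2307.02816 — 7 statements merged into one kernel-verified Lean document; each statement's English description precedes it below -/
import Mathlib

section
/- Let G be a simple graph, let a and b be vertices of G, and let P be a path in G from a to b whose length equals dist_G(a,b) + 1. Then there is an index j such that the initial segment of P from a to its (j-1)-st vertex and the final segment of P from its j-th vertex to b are both geodesics in G; in particular, the vertex set of P is the disjoint union of the vertex sets of two vertex-disjoint geodesics in G. -/
/-- A geodesic in a graph `G` is a path whose length equals the distance in `G`
between its two endpoints. -/
def SimpleGraph.IsGeodesic {V : Type*} (G : SimpleGraph V) {a b : V}
    (p : G.Walk a b) : Prop :=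
  p.IsPath ∧ p.length = G.dist a b

/-- If `P` is a path from `a` to `b` of length `dist a b + 1`, then there is an
index `j` splitting `P` into two vertex-disjoint geodesics: the initial segment
from `a` to the `(j-1)`-st vertex of `P` and the final segment from the `j`-th
vertex of `P` to `b`; their vertex sets partition the vertex set of `P`. -/
theorem stmt1 {V : Type*} [Fintype V] (G : SimpleGraph V) {a b : V}
    (P : G.Walk a b) (hP : P.IsPath) (hlen : P.length = G.dist a b + 1) :
    ∃ j : ℕ, 1 ≤ j ∧ j ≤ P.length ∧
      ∃ (Q : G.Walk a (P.getVert (j - 1))) (R : G.Walk (P.getVert j) b),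
        G.IsGeodesic Q ∧ G.IsGeodesic R ∧
        Q.support = P.support.take j ∧ R.support = P.support.drop j ∧
        Disjoint {v | v ∈ Q.support} {v | v ∈ R.support} ∧
        {v | v ∈ P.support} = {v | v ∈ Q.support} ∪ {v | v ∈ R.support} := by
  classical
  have hex : ∃ j, G.dist a (P.getVert j) < j := ⟨P.length, by rw [SimpleGraph.Walk.getVert_length]; omega⟩
  obtain ⟨j, hj, hmin⟩ : ∃ j, G.dist a (P.getVert j) < j ∧
      ∀ m, m < j → ¬ G.dist a (P.getVert m) < m :=
    ⟨Nat.find hex, Nat.find_spec hex, fun m hm => Nat.find_min hex hm⟩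
  have hjn : j ≤ P.length := by
    by_contra h
    exact hmin P.length (by omega) (by rw [SimpleGraph.Walk.getVert_length]; omega)
  have hj1 : 1 ≤ j := by omega
  have hQs : (P.take (j - 1)).support = P.support.take j := by
    rw [SimpleGraph.Walk.support_take]
    congr 1
    omega
  have hRs : (P.drop j).support = P.support.drop j := by
    rw [SimpleGraph.Walk.drop_support_eq_support_drop_min]
    congr 1
    omega
  have hQl : (P.take (j - 1)).length = j - 1 := by
    rw [SimpleGraph.Walk.take_length]; omega
  have hRl : (P.drop j).length = P.length - j := by
    rw [SimpleGraph.Walk.drop_length]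
  have hnd : (P.support.take j ++ P.support.drop j).Nodup := by
    rw [List.take_append_drop]; exact hP.support_nodup
  rw [List.nodup_append] at hnd
  refine ⟨j, hj1, hjn, P.take (j - 1), P.drop j, ⟨?_, ?_⟩, ⟨?_, ?_⟩, hQs, hRs, ?_, ?_⟩
  · rw [SimpleGraph.Walk.isPath_def, hQs]; exact hnd.1
  · have h1 := hmin (j - 1) (by omega)
    have h2 := SimpleGraph.dist_le (P.take (j - 1))
    omega
  · rw [SimpleGraph.Walk.isPath_def, hRs]; exact hnd.2.1
  · have h2 := SimpleGraph.dist_le (P.drop j)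
    obtain ⟨w1, hw1⟩ := (P.take j).reachable.exists_walk_length_eq_dist
    obtain ⟨w2, hw2⟩ := (P.drop j).reachable.exists_walk_length_eq_dist
    have h3 := SimpleGraph.dist_le (w1.append w2)
    rw [SimpleGraph.Walk.length_append] at h3
    omega
  · rw [Set.disjoint_left]
    intro v h1 h2
    rw [Set.mem_ofPred_eq, hQs] at h1
    rw [Set.mem_ofPred_eq, hRs] at h2
    exact hnd.2.2 v h1 v h2 rfl
  · ext v
    rw [Set.mem_union, Set.mem_ofPred_eq, Set.mem_ofPred_eq, Set.mem_ofPred_eq, hQs, hRs,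
      ← List.mem_append, List.take_append_drop]
end

section
/- Let G be a simple graph, let G0 be a subgraph of G, let S be a subset of V(G0), and let r be a vertex in S. Assume that every edge of G that is not an edge of G0 has both of its endpoints in (V(G) \ V(G0)) ∪ S. Let G' be the graph on vertex set V(G0) whose edge set is E(G0) together with all pairs {r, v} for v in S \ {r}. Then for all u, v in V(G0) that are connected in G, u and v are connected in G' and dist_{G'}(u,v) ≤ dist_G(u,v) + 1. -/
/-- Let `G0` be a subgraph of `G` (with vertex set `V0`), `S ⊆ V0`, `r ∈ S`, and
suppose every edge of `G` that is not an edge of `G0` has both endpoints in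
`(V \ V0) ∪ S`.  Let `G'` be obtained from `G0` by adding all edges `{r, v}` for
`v ∈ S \ {r}`.  Then any two vertices of `V0` connected in `G` are connected in
`G'`, and `dist_{G'}(u,v) ≤ dist_G(u,v) + 1`. -/
theorem stmt2 {V : Type*} [Fintype V] (G G0 : SimpleGraph V) (V0 S : Set V) (r : V)
    (hsub : G0 ≤ G)
    (hV0 : ∀ u v : V, G0.Adj u v → u ∈ V0 ∧ v ∈ V0)
    (hS : S ⊆ V0) (hrS : r ∈ S)
    (hedge : ∀ u v : V, G.Adj u v → ¬ G0.Adj u v →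
      (u ∉ V0 ∨ u ∈ S) ∧ (v ∉ V0 ∨ v ∈ S))
    (G' : SimpleGraph V)
    (hG' : G' = G0 ⊔ SimpleGraph.fromRel (fun x y => x = r ∧ y ∈ S)) :
    ∀ u ∈ V0, ∀ v ∈ V0, G.Reachable u v →
      G'.Reachable u v ∧ G'.dist u v ≤ G.dist u v + 1 := by
  have hr : ∀ a ∈ S, ∃ q : G'.Walk r a, q.length ≤ 1 := by
    intro a ha
    by_cases h : r = a
    · subst h
      exact ⟨SimpleGraph.Walk.nil, by simp⟩
    · have hadj : G'.Adj r a := by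
        rw [hG']
        right
        rw [SimpleGraph.fromRel_adj]
        exact ⟨h, Or.inl ⟨rfl, ha⟩⟩
      exact ⟨SimpleGraph.Walk.cons hadj SimpleGraph.Walk.nil, by simp⟩
  have h0 : ∀ a b, G0.Adj a b → G'.Adj a b := by
    intro a b h
    rw [hG']
    exact Or.inl h
  have key : ∀ (u v : V) (p : G.Walk u v), v ∈ V0 →
      (u ∈ V0 ∧ ∃ q : G'.Walk u v, q.length ≤ p.length) ∨
      ((∃ q : G'.Walk r v, q.length ≤ p.length) ∧
        (u ∈ V0 → ∃ q : G'.Walk u v, q.length ≤ p.length + 1)) := by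
    intro u v p hv
    induction p with
    | nil => exact Or.inl ⟨hv, SimpleGraph.Walk.nil, by simp⟩
    | @cons u w v h p ih =>
      by_cases hg : G0.Adj u w
      · rcases ih hv with ⟨_, q, hq⟩ | ⟨⟨q, hq⟩, h2⟩
        · exact Or.inl ⟨(hV0 _ _ hg).1, SimpleGraph.Walk.cons (h0 _ _ hg) q, by simpa using hq⟩
        · obtain ⟨q', hq'⟩ := h2 (hV0 _ _ hg).2
          exact Or.inr ⟨⟨q, by simp; omega⟩, fun _ =>
            ⟨SimpleGraph.Walk.cons (h0 _ _ hg) q', by simp; omega⟩⟩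
      · obtain ⟨hu, hw⟩ := hedge _ _ h hg
        have hrv : ∃ q : G'.Walk r v, q.length ≤ p.length + 1 := by
          rcases ih hv with ⟨hw0, q, hq⟩ | ⟨⟨q, hq⟩, _⟩
          · obtain ⟨t, ht⟩ := hr w (hw.resolve_left (not_not.mpr hw0))
            exact ⟨t.append q, by rw [SimpleGraph.Walk.length_append]; omega⟩
          · exact ⟨q, by omega⟩
        obtain ⟨q, hq⟩ := hrv
        refine Or.inr ⟨⟨q, by simpa using hq⟩, fun hu0 => ?_⟩
        obtain ⟨t, ht⟩ := hr u (hu.resolve_left (not_not.mpr hu0))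
        exact ⟨t.reverse.append q, by
          rw [SimpleGraph.Walk.length_append, SimpleGraph.Walk.length_reverse,
            SimpleGraph.Walk.length_cons]
          omega⟩
  intro u hu v hv huv
  obtain ⟨p, hp⟩ := huv.exists_walk_length_eq_dist
  have : ∃ q : G'.Walk u v, q.length ≤ p.length + 1 := by
    rcases key u v p hv with ⟨_, q, hq⟩ | ⟨_, h⟩
    · exact ⟨q, by omega⟩
    · exact h hu
  obtain ⟨q, hq⟩ := this
  exact ⟨⟨q⟩, (SimpleGraph.dist_le q).trans (hp ▸ hq)⟩
end

section
/- Let G be a simple graph, let G0 be a subgraph of G, let S be a subset of V(G0), and let r be a vertex in S. Assume that every edge of G that is not an edge of G0 has both of its endpoints in (V(G) \ V(G0)) ∪ S. Let G' be the graph on vertex set V(G0) whose edge set is E(G0) together with all pairs {r, v} for v in S \ {r}. Then for every geodesic P' in G', the vertex set of P' is the union of the vertex sets of at most six pairwise vertex-disjoint geodesics in G, each of which contains at most one vertex of S. -/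
open SimpleGraph

lemma aux_seg {V : Type*} (G : SimpleGraph V) (x : ℕ → V) (i d : ℕ)
    (h : ∀ k, i ≤ k → k < i + d → G.Adj (x k) (x (k+1))) :
    ∃ w : G.Walk (x i) (x (i+d)), w.length = d ∧
      ∀ v, v ∈ w.support ↔ ∃ k, i ≤ k ∧ k ≤ i + d ∧ x k = v := by
  induction d with
  | zero =>
    refine ⟨Walk.nil, rfl, fun v => ?_⟩
    simp only [Walk.support_nil, List.mem_singleton, add_zero]
    constructor
    · rintro rfl; exact ⟨i, le_rfl, le_rfl, rfl⟩
    · rintro ⟨k, h1, h2, rfl⟩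
      rw [le_antisymm h2 h1]
  | succ d ih =>
    obtain ⟨w, hl, hw⟩ := ih (fun k h1 h2 => h k h1 (by omega))
    refine ⟨w.concat (h (i+d) (by omega) (by omega)), by simp [hl], fun v => ?_⟩
    simp only [Walk.support_concat, List.mem_append, List.mem_singleton, hw]
    constructor
    · rintro (⟨k, h1, h2, h3⟩ | h1)
      · exact ⟨k, h1, by omega, h3⟩
      · exact ⟨i + d + 1, by omega, by omega, h1.symm⟩
    · rintro ⟨k, h1, h2, rfl⟩
      by_cases hk : k ≤ i + d
      · exact Or.inl ⟨k, h1, hk, rfl⟩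
      · have : k = i + d + 1 := by omega
        right; rw [this]; rfl

lemma aux_exit {V : Type*} {G G0 G' : SimpleGraph V} {V0 S : Set V}
    (hV0 : ∀ u v : V, G0.Adj u v → u ∈ V0 ∧ v ∈ V0)
    (hedge : ∀ u v : V, G.Adj u v → ¬ G0.Adj u v →
      (u ∉ V0 ∨ u ∈ S) ∧ (v ∉ V0 ∨ v ∈ S))
    (hle : G0 ≤ G') {u v : V} (w : G.Walk u v) (hu : u ∈ V0) :
    (∃ q : G'.Walk u v, q.length ≤ w.length) ∨
    ∃ s ∈ S, ∃ (p : G'.Walk u s) (w2 : G.Walk s v), p.length + w2.length ≤ w.length := by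
  induction w with
  | nil => exact Or.inl ⟨Walk.nil, le_rfl⟩
  | @cons u m v h w ih =>
    by_cases huS : u ∈ S
    · exact Or.inr ⟨u, huS, Walk.nil, Walk.cons h w, by simp⟩
    · have h0 : G0.Adj u m := by
        by_contra hn
        rcases (hedge u m h hn).1 with h1 | h1
        · exact h1 hu
        · exact huS h1
      rcases ih (hV0 _ _ h0).2 with ⟨q, hq⟩ | ⟨s, hs, p, w2, hp⟩
      · exact Or.inl ⟨Walk.cons (hle h0) q, by simp; omega⟩
      · exact Or.inr ⟨s, hs, Walk.cons (hle h0) p, w2, by simp; omega⟩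

lemma aux_two {V : Type*} {G G0 G' : SimpleGraph V} {V0 S : Set V}
    (hV0 : ∀ u v : V, G0.Adj u v → u ∈ V0 ∧ v ∈ V0)
    (hedge : ∀ u v : V, G.Adj u v → ¬ G0.Adj u v →
      (u ∉ V0 ∨ u ∈ S) ∧ (v ∉ V0 ∨ v ∈ S))
    (hle : G0 ≤ G') {u v : V} (w : G.Walk u v) (hu : u ∈ V0) (hv : v ∈ V0) :
    (∃ q : G'.Walk u v, q.length ≤ w.length) ∨
    ∃ s ∈ S, ∃ t ∈ S, ∃ (p : G'.Walk u s) (q : G'.Walk t v),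
      p.length + q.length + 1 ≤ w.length := by
  rcases aux_exit hV0 hedge hle w hu with h | ⟨s, hs, p, w2, hp⟩
  · exact Or.inl h
  rcases aux_exit hV0 hedge hle w2.reverse hv with ⟨q, hq⟩ | ⟨t, ht, q, w3, hq⟩
  · rw [Walk.length_reverse] at hq
    exact Or.inl ⟨p.append q.reverse, by simp; omega⟩
  · rw [Walk.length_reverse] at hq
    by_cases h0 : w3.length = 0
    · have hts := Walk.eq_of_length_eq_zero h0
      subst hts
      exact Or.inl ⟨p.append q.reverse, by simp; omega⟩
    · exact Or.inr ⟨s, hs, t, ht, p, q.reverse, by simp; omega⟩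

/-- Let `G0` be a subgraph of `G` (with vertex set `V0`), `S ⊆ V0`, `r ∈ S`, and
suppose every edge of `G` that is not an edge of `G0` has both endpoints in
`(V \ V0) ∪ S`.  Let `G'` be obtained from `G0` by adding all edges `{r, v}` for
`v ∈ S \ {r}`.  Then the vertex set of every geodesic `P'` in `G'` is the union
of the vertex sets of at most six pairwise vertex-disjoint geodesics in `G`,
each containing at most one vertex of `S`. -/
theorem stmt3 {V : Type*} [Fintype V] (G G0 : SimpleGraph V) (V0 S : Set V) (r : V)
    (hsub : G0 ≤ G)
    (hV0 : ∀ u v : V, G0.Adj u v → u ∈ V0 ∧ v ∈ V0)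
    (hS : S ⊆ V0) (hrS : r ∈ S)
    (hedge : ∀ u v : V, G.Adj u v → ¬ G0.Adj u v →
      (u ∉ V0 ∨ u ∈ S) ∧ (v ∉ V0 ∨ v ∈ S))
    (G' : SimpleGraph V)
    (hG' : G' = G0 ⊔ SimpleGraph.fromRel (fun x y => x = r ∧ y ∈ S))
    {a b : V} (P' : G'.Walk a b) (hP' : G'.IsGeodesic P') :
    ∃ n : ℕ, n ≤ 6 ∧
      ∃ (e : Fin n → V × V) (Q : ∀ i : Fin n, G.Walk (e i).1 (e i).2),
        (∀ i, G.IsGeodesic (Q i)) ∧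
        (∀ i j, i ≠ j →
          Disjoint {v | v ∈ (Q i).support} {v | v ∈ (Q j).support}) ∧
        {v | v ∈ P'.support} = ⋃ i, {v | v ∈ (Q i).support} ∧
        ∀ i, ({v | v ∈ (Q i).support} ∩ S).ncard ≤ 1 := by
  classical
  have hle : G0 ≤ G' := by rw [hG']; exact le_sup_left
  have hadj : ∀ u v, G'.Adj u v → G0.Adj u v ∨ (u ∈ S ∧ v ∈ S) := by
    intro u v h
    rw [hG', SimpleGraph.sup_adj, SimpleGraph.fromRel_adj] at h
    rcases h with h | ⟨_, ⟨rfl, h⟩ | ⟨rfl, h⟩⟩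
    · exact Or.inl h
    · exact Or.inr ⟨hrS, h⟩
    · exact Or.inr ⟨h, hrS⟩
  have hadjV : ∀ u v, G'.Adj u v → u ∈ V0 ∧ v ∈ V0 := by
    intro u v h
    rcases hadj u v h with h | h
    · exact hV0 u v h
    · exact ⟨hS h.1, hS h.2⟩
  have hr : ∀ s ∈ S, ∃ w : G'.Walk r s, w.length ≤ 1 := by
    intro s hs
    by_cases h : r = s
    · subst h; exact ⟨Walk.nil, by simp⟩
    · have : G'.Adj r s := by
        rw [hG', SimpleGraph.sup_adj, SimpleGraph.fromRel_adj]
        exact Or.inr ⟨h, Or.inl ⟨rfl, hs⟩⟩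
      exact ⟨this.toWalk, by simp⟩
  have hSS : ∀ s ∈ S, ∀ t ∈ S, ∃ w : G'.Walk s t, w.length ≤ 2 := by
    intro s hs t ht
    obtain ⟨w1, h1⟩ := hr s hs
    obtain ⟨w2, h2⟩ := hr t ht
    exact ⟨w1.reverse.append w2, by simp; omega⟩
  obtain ⟨hpath, hlen⟩ := hP'
  set L := P'.length with hL
  set x : ℕ → V := P'.getVert with hx
  have hinj : ∀ i j, i ≤ L → j ≤ L → x i = x j → i = j := by
    intro i j hi hj h
    exact hpath.getVert_injOn hi hj h
  have hD : ∀ i j, j ≤ L → ∀ w : G'.Walk (x i) (x j), j ≤ i + w.length := by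
    intro i j hj w
    have h1 := SimpleGraph.dist_le (((P'.take i).append w).append (P'.drop j))
    simp only [Walk.length_append, Walk.take_length, Walk.drop_length] at h1
    omega
  have hstep : ∀ k, k < L → G'.Adj (x k) (x (k+1)) := fun k hk => P'.adj_getVert_succ hk
  -- bad pairs
  let Bad : ℕ → ℕ → Prop := fun i j => j ≤ L ∧ ∃ s ∈ S, ∃ t ∈ S,
    ∃ (p : G'.Walk (x i) s) (q : G'.Walk t (x j)), i + p.length + q.length + 2 ≤ j
  have hBad : ∀ i j k l, Bad i j → Bad k l → k < j := by
    rintro i j k l ⟨hj, s, hs, t, ht, p, q, h1⟩ ⟨hl, s', hs', t', ht', p', q', h2⟩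
    obtain ⟨m, hm⟩ := hSS s hs t' ht'
    have := hD i l hl ((p.append m).append q')
    simp only [Walk.length_append] at this
    omega
  obtain ⟨J, hJ⟩ : ∃ J, ∀ k l, Bad k l → k < J ∧ J ≤ l := by
    by_cases h : ∃ j i, Bad i j
    · refine ⟨Nat.find h, fun k l hkl => ⟨?_, Nat.find_min' h ⟨k, hkl⟩⟩⟩
      obtain ⟨i, hi⟩ := Nat.find_spec h
      exact hBad _ _ _ _ hi hkl
    · exact ⟨0, fun k l hkl => absurd ⟨l, k, hkl⟩ h⟩
  have hgeo : ∀ i j, j ≤ L → ¬ Bad i j → ∀ w : G.Walk (x i) (x j), j ≤ i + w.length := by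
    intro i j hj hb w
    by_contra hlt
    have hi : x i ∈ V0 := (hadjV _ _ (hstep i (by omega))).1
    have hjV : x j ∈ V0 := by
      have := (hadjV _ _ (hstep (j-1) (by omega))).2
      rwa [show j - 1 + 1 = j by omega] at this
    rcases aux_two hV0 hedge hle w hi hjV with ⟨q, hq⟩ | ⟨s, hs, t, ht, p, q, h⟩
    · have := hD i j hj q
      omega
    · exact hb ⟨hj, s, hs, t, ht, p, q, by omega⟩
  -- labels
  let T : ℕ → Finset ℕ := fun k => (Finset.range k).filter (fun m => m ≤ L ∧ x m ∈ S)
  have hTmono : ∀ k l, k ≤ l → (T k).card ≤ (T l).card := by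
    intro k l hkl
    apply Finset.card_le_card
    intro m hm
    simp only [T, Finset.mem_filter, Finset.mem_range] at hm ⊢
    exact ⟨by omega, hm.2⟩
  have hTstrict : ∀ k l, k < l → k ≤ L → x k ∈ S → (T k).card < (T l).card := by
    intro k l hkl hk hkS
    apply Finset.card_lt_card
    rw [Finset.ssubset_iff_of_subset]
    · exact ⟨k, by simp [T, hkl, hk, hkS], by simp [T]⟩
    · intro m hm
      simp only [T, Finset.mem_filter, Finset.mem_range] at hm ⊢
      exact ⟨by omega, hm.2⟩
  have hTcard : ∀ k, (T k).card ≤ 3 := by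
    intro k
    rcases (T k).eq_empty_or_nonempty with h | h
    · simp [h]
    · have hsub : T k ⊆ Finset.Icc ((T k).min' h) ((T k).min' h + 2) := by
        intro m hm
        have h0 := Finset.min'_mem _ h
        have h1 := Finset.min'_le _ m hm
        generalize (T k).min' h = m0 at *
        simp only [T, Finset.mem_filter, Finset.mem_range] at hm h0
        obtain ⟨w, hw⟩ := hSS _ h0.2.2 _ hm.2.2
        have := hD m0 m hm.2.1 w
        rw [Finset.mem_Icc]; omega
      have := Finset.card_le_card hsub
      rw [Nat.card_Icc] at this
      omega
  let g : ℕ → ℕ := fun k => (T k).card + if J ≤ k then 1 else 0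
  have hg : ∀ k l, k ≤ l → g k = g l → (T k).card = (T l).card ∧ (J ≤ l → J ≤ k) := by
    intro k l hkl h
    have := hTmono k l hkl
    simp only [g] at h
    split_ifs at h <;> constructor <;> omega
  have hgmono : ∀ k l, k ≤ l → g k ≤ g l := by
    intro k l hkl
    have := hTmono k l hkl
    simp only [g]
    split_ifs <;> omega
  let I : Finset ℕ := (Finset.range (L+1)).image g
  have hIcard : I.card ≤ 6 := by
    have : I ⊆ Finset.range 5 := by
      intro c hc
      simp only [I, Finset.mem_image] at hc
      obtain ⟨k, _, rfl⟩ := hc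
      have := hTcard k
      simp only [g, Finset.mem_range]
      split_ifs <;> omega
    have := Finset.card_le_card this
    rw [Finset.card_range] at this
    omega
  have hpiece : ∀ c : I, ∃ (e : V × V) (Q : G.Walk e.1 e.2), G.IsGeodesic Q ∧
      ∀ v, v ∈ Q.support ↔ ∃ k, k ≤ L ∧ g k = c ∧ x k = v := by
    rintro ⟨c, hc⟩
    let F := (Finset.range (L+1)).filter (fun k => g k = c)
    have hF : F.Nonempty := by
      simp only [I, Finset.mem_image] at hc
      obtain ⟨k, hk, hkc⟩ := hc
      exact ⟨k, by simp only [F, Finset.mem_filter]; exact ⟨hk, hkc⟩⟩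
    obtain ⟨i, hi, himin⟩ : ∃ i ∈ F, ∀ k ∈ F, i ≤ k :=
      ⟨F.min' hF, F.min'_mem hF, fun k hk => F.min'_le k hk⟩
    obtain ⟨j, hj, hjmax⟩ : ∃ j ∈ F, ∀ k ∈ F, k ≤ j :=
      ⟨F.max' hF, F.max'_mem hF, fun k hk => F.le_max' k hk⟩
    have hij := himin j hj
    simp only [F, Finset.mem_filter, Finset.mem_range] at hi hj himin hjmax
    have hmid : ∀ k, i ≤ k → k ≤ j → g k = c := by
      intro k h1 h2
      have := hgmono i k h1
      have := hgmono k j h2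
      omega
    obtain ⟨d, rfl⟩ := Nat.exists_eq_add_of_le hij
    obtain ⟨w, hwl, hw⟩ := aux_seg G x i d (by
      intro k h1 h2
      rcases hadj _ _ (hstep k (by omega)) with h | h
      · exact hsub h
      · exfalso
        have h3 := hTstrict k (k+1) (by omega) (by omega) h.1
        have h4 := (hg k (k+1) (by omega)
          ((hmid k h1 (by omega)).trans (hmid (k+1) (by omega) (by omega)).symm)).1
        omega)
    have hnb : ¬ Bad i (i+d) := by
      intro hb
      have h1 := hJ _ _ hb
      have h2 := (hg i (i+d) hij (hi.2.trans hj.2.symm)).2 h1.2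
      omega
    have hdist : w.length = G.dist (x i) (x (i+d)) := by
      apply le_antisymm _ (SimpleGraph.dist_le w)
      obtain ⟨w', hw'⟩ := w.reachable.exists_walk_length_eq_dist
      have := hgeo i (i+d) (by omega) hnb w'
      omega
    refine ⟨(x i, x (i+d)), w, ⟨w.isPath_of_length_eq_dist hdist, hdist⟩, fun v => ?_⟩
    rw [hw]
    constructor
    · rintro ⟨k, h1, h2, h3⟩
      exact ⟨k, by omega, hmid k h1 h2, h3⟩
    · rintro ⟨k, h1, h2, h3⟩
      exact ⟨k, himin k ⟨by omega, h2⟩, hjmax k ⟨by omega, h2⟩, h3⟩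
  choose e Q hQ hQs using hpiece
  let φ := I.equivFin
  refine ⟨I.card, hIcard, fun i => e (φ.symm i), fun i => Q (φ.symm i), fun i => hQ _, ?_, ?_, ?_⟩
  · intro i j hne
    rw [Set.disjoint_left]
    intro v hv hv'
    simp only [Set.mem_setOf_eq, hQs] at hv hv'
    obtain ⟨k, h1, h2, h3⟩ := hv
    obtain ⟨l, h4, h5, h6⟩ := hv'
    have := hinj k l h1 h4 (h3.trans h6.symm)
    subst this
    exact hne (φ.symm.injective (Subtype.ext (h2.symm.trans h5)))
  · ext v
    simp only [Set.mem_setOf_eq, Set.mem_iUnion, hQs]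
    rw [Walk.mem_support_iff_exists_getVert]
    constructor
    · rintro ⟨k, h1, h2⟩
      have hk : g k ∈ I := Finset.mem_image_of_mem g (Finset.mem_range.2 (by omega))
      exact ⟨φ ⟨g k, hk⟩, k, h2, by simp, h1⟩
    · rintro ⟨_, k, h1, _, h3⟩
      exact ⟨k, h3, h1⟩
  · intro i
    rw [Set.ncard_le_one (Set.toFinite _)]
    rintro u ⟨hu, huS⟩ v ⟨hv, hvS⟩
    simp only [Set.mem_setOf_eq, hQs] at hu hv
    obtain ⟨k, h1, h2, rfl⟩ := hu
    obtain ⟨l, h4, h5, rfl⟩ := hv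
    rcases lt_trichotomy k l with h | h | h
    · have := hTstrict k l h h1 huS
      have := (hg k l h.le (h2.trans h5.symm)).1
      omega
    · rw [h]
    · have := hTstrict l k h h4 hvS
      have := (hg l k h.le (h5.trans h2.symm)).1
      omega
end

section
/- Let T be a finite tree, let d ≥ 1 be an integer, and let F be a family of nonempty subsets of V(T), each of which induces a connected subgraph of T. If F does not contain d pairwise disjoint members, then there exists a set Z of at most d−1 vertices of T such that every member of F intersects Z. -/
/-- `t` is a vertex of `C` at minimal distance from `r`. -/
def IsTop4 {V : Type*} (T : SimpleGraph V) (r t : V) (C : Set V) : Prop :=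
  t ∈ C ∧ ∀ y ∈ C, T.dist r t ≤ T.dist r y

lemma step4 {V : Type*} (T : SimpleGraph V) (hT : T.IsTree) (r t x y : V)
    (hx : ∀ p : T.Walk r x, t ∈ p.support) (hxy : T.Adj x y)
    (hy : T.dist r t ≤ T.dist r y) (p : T.Walk r y) : t ∈ p.support := by
  classical
  by_contra hp
  have h1 := hx (p.concat hxy.symm)
  rw [SimpleGraph.Walk.support_concat] at h1
  have h2 : t = x := by
    simp at h1
    exact h1.resolve_left hp
  subst h2
  have hpp : t ∉ p.bypass.support := fun h => hp (p.support_bypass_subset_support h)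
  have hpath : (p.bypass.concat hxy.symm).IsPath := (p.bypass_isPath).concat hpp hxy.symm
  obtain ⟨q, hq, hql⟩ := hT.connected.exists_path_of_dist r t
  have := (hT.existsUnique_path r t).unique hq hpath
  have h3 := congrArg SimpleGraph.Walk.length this
  rw [SimpleGraph.Walk.length_concat] at h3
  have := SimpleGraph.dist_le p.bypass
  omega

lemma desc4 {V : Type*} (T : SimpleGraph V) (hT : T.IsTree) (r t : V) (C : Set V)
    (hC : (T.induce C).Connected) (ht : IsTop4 T r t C) (x : V) (hx : x ∈ C)
    (p : T.Walk r x) : t ∈ p.support := by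
  have key : ∀ a b : C, (w : (T.induce C).Walk a b) →
      (∀ p : T.Walk r a, t ∈ p.support) → (∀ p : T.Walk r b, t ∈ p.support) := by
    intro a b w
    induction w with
    | nil => exact fun h => h
    | @cons u v w hadj _ ih =>
      intro h
      exact ih (fun p => step4 T hT r t u v h hadj (ht.2 v v.2) p)
  obtain ⟨w⟩ := hC.preconnected ⟨t, ht.1⟩ ⟨x, hx⟩
  exact key _ _ w (fun p => p.end_mem_support) p

lemma meet4 {V : Type*} (T : SimpleGraph V) (hT : T.IsTree) (r t s : V) (C D : Set V)
    (hC : (T.induce C).Connected) (hD : (T.induce D).Connected) (ht : IsTop4 T r t C)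
    (hs : IsTop4 T r s D) (hst : T.dist r s ≤ T.dist r t) (x : V) (hxC : x ∈ C) (hxD : x ∈ D) :
    t ∈ D := by
  classical
  obtain ⟨w⟩ := hD.preconnected ⟨s, hs.1⟩ ⟨x, hxD⟩
  obtain ⟨q, hq, hql⟩ := hT.connected.exists_path_of_dist r s
  have h := desc4 T hT r t C hC ht x hxC
    (q.append (w.map (SimpleGraph.Embedding.induce D).toHom))
  replace h := (SimpleGraph.Walk.mem_support_append_iff _ _).1 h
  rcases h with h | h
  · have h1 := SimpleGraph.dist_le (q.takeUntil t h)
    have h2 := congrArg SimpleGraph.Walk.length (q.take_spec h)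
    rw [SimpleGraph.Walk.length_append] at h2
    have h3 : (q.dropUntil t h).length = 0 := by omega
    have := SimpleGraph.Walk.eq_of_length_eq_zero h3
    exact this ▸ hs.1
  · replace h := List.mem_map.1 ((SimpleGraph.Walk.support_map _ w) ▸ h)
    obtain ⟨a, -, rfl⟩ := h
    exact a.2

lemma main4 {V : Type*} [Fintype V] (T : SimpleGraph V) (hT : T.IsTree) (r : V)
    (n : ℕ) : ∀ (F : Set (Set V)),
    (∀ C ∈ F, C.Nonempty ∧ (T.induce C).Connected) →
    (¬ ∃ f : Fin (n + 1) → Set V, (∀ i, f i ∈ F) ∧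
      ∀ i j, i ≠ j → Disjoint (f i) (f j)) →
    ∃ Z : Finset V, Z.card ≤ n ∧ ∀ C ∈ F, ∃ v ∈ C, v ∈ Z := by
  classical
  induction n with
  | zero =>
    intro F _ hnd
    refine ⟨∅, by simp, fun C hC => (hnd ⟨fun _ => C, fun _ => hC, ?_⟩).elim⟩
    intro i j hij
    exact (hij (by omega)).elim
  | succ n ih =>
    intro F hF hnd
    have htop : ∀ C ∈ F, ∃ t, IsTop4 T r t C := fun C hC =>
      Set.exists_min_image C (T.dist r) (Set.toFinite C) (hF C hC).1
    by_cases hne : F.Nonempty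
    · obtain ⟨C₀, hC₀⟩ := hne
      obtain ⟨t₀, ht₀⟩ := htop C₀ hC₀
      obtain ⟨t, ⟨C, hC, ht⟩, hmax⟩ := Set.exists_max_image {t | ∃ C ∈ F, IsTop4 T r t C}
        (T.dist r) (Set.toFinite _) ⟨t₀, C₀, hC₀, ht₀⟩
      have hdisj : ∀ D ∈ F, t ∉ D → Disjoint C D := by
        intro D hD htD
        rw [Set.disjoint_left]
        intro x hxC hxD
        obtain ⟨s, hs⟩ := htop D hD
        exact htD (meet4 T hT r t s C D (hF C hC).2 (hF D hD).2 ht hs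
          (hmax s ⟨D, hD, hs⟩) x hxC hxD)
      obtain ⟨Z, hZ, hZF⟩ := ih {D ∈ F | t ∉ D} (fun D hD => hF D hD.1) (by
        rintro ⟨f, hf, hfd⟩
        refine hnd ⟨Fin.cons C f, ?_, ?_⟩
        · intro i
          refine Fin.cases ?_ (fun i => ?_) i
          · simpa using hC
          · simpa using (hf i).1
        · intro i j
          refine Fin.cases ?_ (fun i => ?_) i <;> refine Fin.cases ?_ (fun j => ?_) j
          · simp
          · intro _
            simpa using hdisj _ (hf j).1 (hf j).2
          · intro _
            simpa using (hdisj _ (hf i).1 (hf i).2).symm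
          · intro hij
            simpa using hfd i j (fun h => hij (by rw [h])))
      refine ⟨insert t Z, (Finset.card_insert_le _ _).trans (by omega), fun D hD => ?_⟩
      by_cases htD : t ∈ D
      · exact ⟨t, htD, by simp⟩
      · obtain ⟨v, hv, hvZ⟩ := hZF D ⟨hD, htD⟩
        exact ⟨v, hv, by simp [hvZ]⟩
    · exact ⟨∅, by simp, fun C hC => (hne ⟨C, hC⟩).elim⟩

/-- Helly property for subtrees of a tree: if a family `F` of nonempty subsets of
the vertices of a finite tree `T`, each inducing a connected subgraph of `T`,
has no `d` pairwise disjoint members, then some set of at most `d - 1` vertices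
meets every member of `F`. -/
theorem stmt4 {V : Type*} [Fintype V] (T : SimpleGraph V) (hT : T.IsTree)
    (d : ℕ) (hd : 1 ≤ d) (F : Set (Set V))
    (hF : ∀ C ∈ F, C.Nonempty ∧ (T.induce C).Connected)
    (hnd : ¬ ∃ f : Fin d → Set V, (∀ i, f i ∈ F) ∧
      ∀ i j, i ≠ j → Disjoint (f i) (f j)) :
    ∃ Z : Finset V, Z.card ≤ d - 1 ∧ ∀ C ∈ F, ∃ v ∈ C, v ∈ Z := by
  obtain ⟨n, rfl⟩ : ∃ n, d = n + 1 := ⟨d - 1, by omega⟩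
  obtain ⟨r⟩ := hT.connected.nonempty
  exact main4 T hT r n F hF hnd
end

section
/- Let G be a finite simple graph with a tree-decomposition (T, (B_x | x ∈ V(T))), let d ≥ 1 be an integer, and let F be a family of nonempty subsets of V(G), each of which induces a connected subgraph of G. Then either F contains d pairwise disjoint members, or there exist an integer d' ≤ d−1 and nodes x_1, …, x_{d'} of T such that every member of F intersects B_{x_1} ∪ … ∪ B_{x_{d'}}. -/
open SimpleGraph in
/-- The set of nodes whose bag meets a connected set is connected in the tree. -/
theorem trace_reachable {V W : Type*} (G : SimpleGraph V) (T : SimpleGraph W) (B : W → Set V)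
    (hB2 : ∀ u v : V, G.Adj u v → ∃ x : W, u ∈ B x ∧ v ∈ B x)
    (hB3 : ∀ v : V, (T.induce {x : W | v ∈ B x}).Connected)
    (C : Set V) (u v : C) (p : (G.induce C).Walk u v) :
    ∀ (x y : W) (hx : u.1 ∈ B x) (hy : v.1 ∈ B y),
      (T.induce {x : W | ∃ v ∈ C, v ∈ B x}).Reachable ⟨x, u, u.2, hx⟩ ⟨y, v, v.2, hy⟩ := by
  have key : ∀ (u : C) (x y : W) (hx : u.1 ∈ B x) (hy : u.1 ∈ B y),
      (T.induce {x : W | ∃ v ∈ C, v ∈ B x}).Reachable ⟨x, u, u.2, hx⟩ ⟨y, u, u.2, hy⟩ := by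
    intro u x y hx hy
    have h := (hB3 u.1).preconnected ⟨x, hx⟩ ⟨y, hy⟩
    have hle : {x : W | u.1 ∈ B x} ≤ {x : W | ∃ v ∈ C, v ∈ B x} := fun z hz => ⟨u, u.2, hz⟩
    exact h.map (induceHomOfLE T hle).toHom
  induction p with
  | nil => exact fun x y hx hy => key _ x y hx hy
  | cons hadj p ih =>
    intro x y hx hy
    obtain ⟨z, hz1, hz2⟩ := hB2 _ _ hadj
    exact (key _ x z hx hz1).trans (ih z y hz2 hy)

open SimpleGraph in
theorem exists_path_in {W : Type*} (T : SimpleGraph W) (S : Set W)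
    (hS : (T.induce S).Preconnected) (x y : W) (hx : x ∈ S) (hy : y ∈ S) :
    ∃ p : T.Walk x y, p.IsPath ∧ ∀ z ∈ p.support, z ∈ S := by
  classical
  obtain ⟨q⟩ := hS ⟨x, hx⟩ ⟨y, hy⟩
  let q' : T.Walk x y := q.map (Embedding.induce S).toHom
  refine ⟨q'.bypass, q'.bypass_isPath, fun z hz => ?_⟩
  have h1 : z ∈ q'.support := q'.support_bypass_subset_support hz
  have h2 : q'.support = q.support.map (Embedding.induce S).toHom :=
    Walk.support_map (Embedding.induce S).toHom q
  rw [h2] at h1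
  obtain ⟨w, -, rfl⟩ := List.mem_map.1 h1
  exact w.2

open SimpleGraph in
theorem top_path {W : Type*} (T : SimpleGraph W) (hT : T.IsTree) (r : W) (S : Set W)
    (hS : (T.induce S).Preconnected) (x y : W) (hx : x ∈ S) (hy : y ∈ S)
    (hmin : ∀ z ∈ S, T.dist r x ≤ T.dist r z) :
    ∃ (p : T.Walk r x) (q : T.Walk x y), (p.append q).IsPath ∧ p.length = T.dist r x ∧
      ∀ z ∈ q.support, z ∈ S := by
  classical
  obtain ⟨q, hq, hqS⟩ := exists_path_in T S hS x y hx hy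
  obtain ⟨p, hp, hpl⟩ := hT.connected.exists_path_of_dist r x
  refine ⟨p, q, ?_, hpl, hqS⟩
  have hps : ∀ z ∈ p.support, z ∈ q.support → z = x := by
    intro z hz hzq
    have h1 := hmin z (hqS z hzq)
    have h2 : T.dist r z ≤ (p.takeUntil z hz).length := dist_le _
    have h3 : (p.takeUntil z hz).length + (p.dropUntil z hz).length = p.length := by
      rw [← Walk.length_append, Walk.take_spec]
    exact Walk.eq_of_length_eq_zero (p := p.dropUntil z hz) (by omega)
  rw [Walk.isPath_def, Walk.support_append, List.nodup_append']
  refine ⟨hp.support_nodup, hq.support_nodup.tail, ?_⟩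
  intro z hz hzq
  have hzx := hps z hz (List.mem_of_mem_tail hzq)
  subst hzx
  have := hq.support_nodup
  rw [Walk.support_eq_cons] at this
  exact (List.nodup_cons.1 this).1 hzq

open SimpleGraph in
theorem top_mem {W : Type*} (T : SimpleGraph W) (hT : T.IsTree) (r : W) (S S' : Set W)
    (hS : (T.induce S).Preconnected) (hS' : (T.induce S').Preconnected)
    (x x' y : W) (hx : x ∈ S) (hx' : x' ∈ S') (hy : y ∈ S) (hy' : y ∈ S')
    (hmin : ∀ z ∈ S, T.dist r x ≤ T.dist r z)
    (hmin' : ∀ z ∈ S', T.dist r x' ≤ T.dist r z) (hle : T.dist r x' ≤ T.dist r x) :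
    x ∈ S' := by
  classical
  obtain ⟨p, q, hpq, hpl, hqS⟩ := top_path T hT r S hS x y hx hy hmin
  obtain ⟨p', q', hpq', hpl', hqS'⟩ := top_path T hT r S' hS' x' y hx' hy' hmin'
  have heq : p.append q = p'.append q' :=
    congrArg Subtype.val (hT.isAcyclic.path_unique ⟨_, hpq⟩ ⟨_, hpq'⟩)
  have hmem : x ∈ (p'.append q').support := by
    rw [← heq, Walk.mem_support_append_iff]; exact Or.inl p.end_mem_support
  rw [Walk.mem_support_append_iff] at hmem
  rcases hmem with h | h
  · have h2 : T.dist r x ≤ (p'.takeUntil x h).length := dist_le _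
    have h3 : (p'.takeUntil x h).length + (p'.dropUntil x h).length = p'.length := by
      rw [← Walk.length_append, Walk.take_spec]
    have : x = x' := Walk.eq_of_length_eq_zero (p := p'.dropUntil x h) (by omega)
    exact this ▸ hx'
  · exact hqS' x h

/-- Greedy argument, abstractly. -/
theorem greedy {V W : Type*} [Finite V] (B : W → Set V) (top : Set V → W) (depth : W → ℕ) (d : ℕ) :
    ∀ F : Set (Set V),
    (∀ C ∈ F, ∀ C' ∈ F, depth (top C') ≤ depth (top C) → ¬ Disjoint C C' →
      ∃ v ∈ C', v ∈ B (top C)) →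
    (∃ f : Fin (d + 1) → Set V, (∀ i, f i ∈ F) ∧
      ∀ i j, i ≠ j → Disjoint (f i) (f j)) ∨
    (∃ d' : ℕ, d' ≤ d ∧ ∃ x : Fin d' → W,
      ∀ C ∈ F, ∃ v ∈ C, ∃ i : Fin d', v ∈ B (x i)) := by
  induction d with
  | zero =>
    intro F hF
    rcases F.eq_empty_or_nonempty with rfl | ⟨C, hC⟩
    · exact Or.inr ⟨0, le_rfl, Fin.elim0, by simp⟩
    · exact Or.inl ⟨fun _ => C, fun _ => hC, fun i j h => absurd (Fin.ext (by omega)) h⟩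
  | succ d ih =>
    intro F hF
    rcases F.eq_empty_or_nonempty with rfl | hne
    · exact Or.inr ⟨0, Nat.zero_le _, Fin.elim0, by simp⟩
    obtain ⟨C, hC, hmax⟩ := Set.exists_max_image F (fun C => depth (top C)) F.toFinite hne
    rcases ih {C' ∈ F | ¬ ∃ v ∈ C', v ∈ B (top C)}
      (fun A hA A' hA' => hF A hA.1 A' hA'.1) with ⟨f, hf, hdisj⟩ | ⟨d', hd', x, hx⟩
    · left
      have hCf : ∀ i, Disjoint C (f i) := fun i => by
        by_contra h
        exact (hf i).2 (hF C hC (f i) (hf i).1 (hmax _ (hf i).1) h)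
      refine ⟨Fin.cons C f, fun i => ?_, fun i j => ?_⟩
      · refine Fin.cases ?_ (fun i => ?_) i
        · simpa using hC
        · simpa using (hf i).1
      · refine Fin.cases ?_ (fun i => ?_) i <;> refine Fin.cases ?_ (fun j => ?_) j
        · simp
        · intro _; simpa using hCf j
        · intro _; simpa using (hCf i).symm
        · intro h; simpa using hdisj i j (fun e => h (by rw [e]))
    · right
      refine ⟨d' + 1, by omega, Fin.cons (top C) x, fun A hA => ?_⟩
      by_cases h : ∃ v ∈ A, v ∈ B (top C)
      · obtain ⟨v, hv, hvB⟩ := h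
        exact ⟨v, hv, 0, by simpa using hvB⟩
      · obtain ⟨v, hv, i, hi⟩ := hx A ⟨hA, h⟩
        exact ⟨v, hv, i.succ, by simpa using hi⟩

/-- Let `G` have a tree-decomposition `(T, B)` and let `F` be a family of
nonempty subsets of `V(G)`, each inducing a connected subgraph of `G`.  Then
either `F` contains `d` pairwise disjoint members, or there are `d' ≤ d - 1`
bags whose union meets every member of `F`. -/
theorem stmt5 {V W : Type*} [Fintype V] [Fintype W]
    (G : SimpleGraph V) (T : SimpleGraph W) (hT : T.IsTree) (B : W → Set V)
    (hB1 : ∀ v : V, ∃ x : W, v ∈ B x)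
    (hB2 : ∀ u v : V, G.Adj u v → ∃ x : W, u ∈ B x ∧ v ∈ B x)
    (hB3 : ∀ v : V, (T.induce {x : W | v ∈ B x}).Connected)
    (d : ℕ) (hd : 1 ≤ d) (F : Set (Set V))
    (hF : ∀ C ∈ F, C.Nonempty ∧ (G.induce C).Connected) :
    (∃ f : Fin d → Set V, (∀ i, f i ∈ F) ∧
      ∀ i j, i ≠ j → Disjoint (f i) (f j)) ∨
    (∃ d' : ℕ, d' ≤ d - 1 ∧ ∃ x : Fin d' → W,
      ∀ C ∈ F, ∃ v ∈ C, ∃ i : Fin d', v ∈ B (x i)) := by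
  classical
  obtain ⟨r⟩ := hT.connected.nonempty
  obtain ⟨d, rfl⟩ : ∃ e, d = e + 1 := ⟨d - 1, by omega⟩
  have hconn : ∀ C ∈ F, (T.induce {x : W | ∃ v ∈ C, v ∈ B x}).Preconnected := by
    rintro C hC ⟨x, u, hu, hx⟩ ⟨y, v, hv, hy⟩
    obtain ⟨p⟩ := (hF C hC).2.preconnected ⟨u, hu⟩ ⟨v, hv⟩
    exact trace_reachable G T B hB2 hB3 C _ _ p x y hx hy
  have htop : ∀ C : Set V, ∃ x : W, C ∈ F → (∃ v ∈ C, v ∈ B x) ∧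
      ∀ z, (∃ v ∈ C, v ∈ B z) → T.dist r x ≤ T.dist r z := by
    intro C
    by_cases hC : C ∈ F
    · obtain ⟨v, hv⟩ := (hF C hC).1
      obtain ⟨x, hx⟩ := hB1 v
      obtain ⟨y, hy, hmin⟩ := Set.exists_min_image {x : W | ∃ v ∈ C, v ∈ B x}
        (fun x => T.dist r x) (Set.toFinite _) ⟨x, v, hv, hx⟩
      exact ⟨y, fun _ => ⟨hy, hmin⟩⟩
    · exact ⟨r, fun h => absurd h hC⟩
  choose top htop using htop
  refine greedy B top (fun x => T.dist r x) d F ?_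
  intro C hC C' hC' hle hnd
  obtain ⟨v, hv, hv'⟩ := Set.not_disjoint_iff.1 hnd
  obtain ⟨y, hy⟩ := hB1 v
  exact top_mem T hT r {x : W | ∃ v ∈ C, v ∈ B x} {x : W | ∃ v ∈ C', v ∈ B x}
    (hconn C hC) (hconn C' hC') (top C) (top C') y (htop C hC).1 (htop C' hC').1
    ⟨v, hv, hy⟩ ⟨v, hv', hy⟩ (htop C hC).2 (htop C' hC').2 hle
end

section
/- Let G be a finite simple graph with a tree-decomposition (T, (B_x | x ∈ V(T))), let x be a node of T, and let C be a nonempty subset of V(G) inducing a connected subgraph of G with C ∩ B_x = ∅. Let u and v be two distinct vertices of B_x such that u has a neighbor in C and v has a neighbor in C. Then there exists a node y of T with y ≠ x and u, v ∈ B_y. -/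
/-- `a` and `b` are joined by a walk avoiding `x`. -/
def AvoidReach {W : Type*} (T : SimpleGraph W) (x a b : W) : Prop :=
  ∃ p : T.Walk a b, x ∉ p.support

theorem AvoidReach.trans {W : Type*} {T : SimpleGraph W} {x a b c : W}
    (h : AvoidReach T x a b) (h2 : AvoidReach T x b c) : AvoidReach T x a c := by
  obtain ⟨p, hp⟩ := h
  obtain ⟨q, hq⟩ := h2
  refine ⟨p.append q, ?_⟩
  rw [SimpleGraph.Walk.mem_support_append_iff]
  tauto

theorem AvoidReach.symm {W : Type*} {T : SimpleGraph W} {x a b : W}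
    (h : AvoidReach T x a b) : AvoidReach T x b a := by
  obtain ⟨p, hp⟩ := h
  exact ⟨p.reverse, by simpa using hp⟩

theorem avoidReach_of_connected {W : Type*} {T : SimpleGraph W} {x a b : W} {S : Set W}
    (hS : (T.induce S).Connected) (hx : x ∉ S) (ha : a ∈ S) (hb : b ∈ S) :
    AvoidReach T x a b := by
  obtain ⟨p⟩ := hS.preconnected ⟨a, ha⟩ ⟨b, hb⟩
  refine ⟨p.map (SimpleGraph.Embedding.induce S).toHom, ?_⟩
  intro h
  replace h := List.mem_map.1 ((congrArg (fun l => x ∈ l) (SimpleGraph.Walk.support_map (SimpleGraph.Embedding.induce S).toHom p)).mp h)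
  obtain ⟨z, _, hz⟩ := h
  exact hx (hz ▸ z.2)

theorem exists_nbr_avoidReach {W : Type*} {T : SimpleGraph W} {x a : W} {S : Set W}
    (hS : (T.induce S).Connected) (hx : x ∈ S) (ha : a ∈ S) (hax : a ≠ x) :
    ∃ y ∈ S, T.Adj x y ∧ AvoidReach T x y a := by
  obtain ⟨p, hp⟩ := (hS.preconnected ⟨x, hx⟩ ⟨a, ha⟩).exists_isPath
  cases p with
  | nil => exact absurd rfl hax
  | @cons _ y _ h q =>
    rw [SimpleGraph.Walk.cons_isPath_iff] at hp
    refine ⟨y.1, y.2, h, q.map (SimpleGraph.Embedding.induce S).toHom, ?_⟩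
    intro h
    replace h := List.mem_map.1 ((congrArg (fun l => x ∈ l) (SimpleGraph.Walk.support_map (SimpleGraph.Embedding.induce S).toHom q)).mp h)
    obtain ⟨z, hz1, hz⟩ := h
    have : z = ⟨x, hx⟩ := Subtype.ext hz
    exact hp.2 (this ▸ hz1)

theorem nbr_unique {W : Type*} {T : SimpleGraph W} (hT : T.IsTree) {x y z : W}
    (hy : T.Adj x y) (hz : T.Adj x z) (h : AvoidReach T x y z) : y = z := by
  classical
  obtain ⟨p, hp⟩ := h
  have h1 : (SimpleGraph.Walk.cons hy p.bypass).IsPath := by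
    rw [SimpleGraph.Walk.cons_isPath_iff]
    exact ⟨p.bypass_isPath, fun h => hp (p.support_bypass_subset_support h)⟩
  have h2 : (SimpleGraph.Walk.cons hz SimpleGraph.Walk.nil).IsPath := by
    simp [hz.ne]
  have := (hT.existsUnique_path x z).unique h1 h2
  have h3 := congrArg (fun w => w.snd) this
  simpa using h3

/-- Let `G` have a tree-decomposition `(T, B)`, let `x` be a node of `T`, and let
`C` be a nonempty connected subset of `V(G)` disjoint from the bag `B x`.  If
`u ≠ v` are vertices of `B x` each having a neighbour in `C`, then some bag
`B y` with `y ≠ x` contains both `u` and `v`. -/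
theorem stmt7 {V W : Type*} [Fintype V] [Fintype W]
    (G : SimpleGraph V) (T : SimpleGraph W) (hT : T.IsTree) (B : W → Set V)
    (hB1 : ∀ v : V, ∃ x : W, v ∈ B x)
    (hB2 : ∀ u v : V, G.Adj u v → ∃ x : W, u ∈ B x ∧ v ∈ B x)
    (hB3 : ∀ v : V, (T.induce {x : W | v ∈ B x}).Connected)
    (x : W) (C : Set V) (hC : C.Nonempty) (hCconn : (G.induce C).Connected)
    (hCB : C ∩ B x = ∅)
    (u v : V) (hu : u ∈ B x) (hv : v ∈ B x) (huv : u ≠ v)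
    (hun : ∃ c ∈ C, G.Adj u c) (hvn : ∃ c ∈ C, G.Adj v c) :
    ∃ y : W, y ≠ x ∧ u ∈ B y ∧ v ∈ B y := by
  have hxC : ∀ c ∈ C, c ∉ B x := fun c hc hcx => by
    have : c ∈ C ∩ B x := ⟨hc, hcx⟩
    rw [hCB] at this
    exact this
  have hsame : ∀ c ∈ C, ∀ a b, c ∈ B a → c ∈ B b → AvoidReach T x a b :=
    fun c hc a b ha hb => avoidReach_of_connected (hB3 c) (hxC c hc) ha hb
  have hall : ∀ c d : C, (G.induce C).Walk c d →
      ∀ a b, c.1 ∈ B a → d.1 ∈ B b → AvoidReach T x a b := by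
    intro c d p
    induction p with
    | nil => exact hsame _ (Subtype.prop _)
    | @cons c e d h q ih =>
      intro a b ha hb
      obtain ⟨w, hw1, hw2⟩ := hB2 c.1 e.1 h
      exact (hsame c.1 c.2 a w ha hw1).trans (ih w b hw2 hb)
  obtain ⟨c, hc, huc⟩ := hun
  obtain ⟨d, hd, hvd⟩ := hvn
  obtain ⟨a, hua, hca⟩ := hB2 _ _ huc
  obtain ⟨b, hvb, hdb⟩ := hB2 _ _ hvd
  have hax : a ≠ x := fun h => hxC c hc (h ▸ hca)
  have hbx : b ≠ x := fun h => hxC d hd (h ▸ hdb)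
  obtain ⟨y, hy, hxy, hya⟩ := exists_nbr_avoidReach (hB3 u) hu hua hax
  obtain ⟨z, hz, hxz, hzb⟩ := exists_nbr_avoidReach (hB3 v) hv hvb hbx
  obtain ⟨p⟩ := hCconn.preconnected ⟨c, hc⟩ ⟨d, hd⟩
  have hyz : y = z :=
    nbr_unique hT hxy hxz ((hya.trans (hall _ _ p a b hca hdb)).trans hzb.symm)
  exact ⟨y, hxy.ne', hy, hyz ▸ hz⟩
end

section
/- Let H be a finite simple graph, let B ⊆ V(H), and let I be a set of unordered pairs of distinct vertices of B such that: (i) each pair {u,v} ∈ I consists of vertices connected in H; and (ii) for every path in H between two distinct vertices u, v of B that has at least one internal vertex and all of whose internal vertices lie outside B, the pair {u,v} belongs to I. Let H* be a finite simple graph with B ⊆ V(H*) such that: two vertices of B are adjacent in H* if and only if they are adjacent in H; for each {u,v} ∈ I there are two u–v paths π_{uv} and π'_{uv} in H*, of lengths dist_H(u,v) and dist_H(u,v)+1 respectively, whose internal vertices lie outside B and such that all these paths (over all pairs in I) are pairwise internally disjoint; every vertex of V(H*) \ B is an internal vertex of one of these paths; and every edge of H* either joins two vertices of B or is an edge of one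 of these paths. Then for all u, v ∈ B: dist_{H*}(u,v) = dist_H(u,v); moreover, for every geodesic R* in H* joining two vertices u, v of B, there exists a geodesic R in H joining u and v such that V(R*) ∩ B ⊆ V(R) ∩ B. -/
/-- The internal vertices of a walk: all vertices of its support except the two
endpoints. -/
def SimpleGraph.Walk.internals {V : Type*} {G : SimpleGraph V} {a b : V}
    (p : G.Walk a b) : List V :=
  p.support.tail.dropLast

namespace Stmt8
open SimpleGraph

theorem mem_internals {V : Type*} {G : SimpleGraph V} {a b : V} (p : G.Walk a b) (w : V) :
    w ∈ p.internals ↔ ∃ i, 0 < i ∧ i < p.length ∧ p.getVert i = w := by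
  unfold SimpleGraph.Walk.internals
  rw [List.mem_iff_getElem]
  constructor
  · rintro ⟨i, hi, rfl⟩
    have hi' := hi
    simp at hi'
    refine ⟨i + 1, by omega, by omega, ?_⟩
    simp [SimpleGraph.Walk.support_getElem_eq_getVert]
  · rintro ⟨i, h0, hi, rfl⟩
    refine ⟨i - 1, by simp; omega, ?_⟩
    simp [SimpleGraph.Walk.support_getElem_eq_getVert, Nat.sub_add_cancel h0]

theorem edge_getVert {V : Type*} {G : SimpleGraph V} {a b : V} (p : G.Walk a b) (x y : V)
    (h : s(x, y) ∈ p.edges) : ∃ i, i < p.length ∧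
      ((x = p.getVert i ∧ y = p.getVert (i + 1)) ∨ (x = p.getVert (i + 1) ∧ y = p.getVert i)) := by
  induction p with
  | nil => simp at h
  | cons hadj q ih =>
    rw [Walk.edges_cons, List.mem_cons] at h
    rcases h with h | h
    · refine ⟨0, by simp, ?_⟩
      simpa using h
    · obtain ⟨i, hi, h⟩ := ih h
      exact ⟨i + 1, by simpa using hi, by simpa using h⟩

theorem lower {V W : Type*} (H : SimpleGraph V) (Hs : SimpleGraph W) (B : Set V) (f : V → W)
    (key : ∀ u ∈ B, ∀ x ∈ B, u ≠ x → ∀ s : H.Walk u x, s.IsPath →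
      (∀ w ∈ s.internals, w ∉ B) → ∃ q : Hs.Walk (f u) (f x), q.length ≤ s.length)
    {x v : V} (p : H.Walk x v) : v ∈ B → ∀ u ∈ B, ∀ s : H.Walk u x,
      (∀ w ∈ s.support, w ∈ B → w = u) →
      ∃ q : Hs.Walk (f u) (f v), q.length ≤ s.length + p.length := by
  classical
  induction p with
  | nil =>
    intro hv u hu s hs
    obtain rfl := hs _ s.end_mem_support hv
    exact ⟨Walk.nil, by simp⟩
  | @cons x x' v hadj p ih =>
    intro hv u hu s hs
    by_cases hx' : x' ∈ B
    · obtain ⟨q, hq⟩ := ih hv x' hx' Walk.nil (by simp)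
      by_cases hux : u = x'
      · subst hux
        exact ⟨q, by simp at hq ⊢; omega⟩
      · set t := s.concat hadj with ht
        have hb := Walk.bypass_isPath t
        obtain ⟨q0, hq0⟩ := key u hu x' hx' hux t.bypass hb (by
          intro w hw hwB
          obtain ⟨i, h0, hi, rfl⟩ := (mem_internals _ _).1 hw
          have hm : t.bypass.getVert i ∈ t.support :=
            Walk.support_bypass_subset_support _ (Walk.getVert_mem_support _ _)
          rw [ht, Walk.support_concat, List.mem_append, List.mem_singleton] at hm
          rcases hm with hm | hm
          · have h1 := hs _ hm hwB
            have := hb.getVert_injOn (x₁ := i) (x₂ := 0) (by simp; omega) (by simp)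
              (by rw [Walk.getVert_zero]; exact h1)
            omega
          · have := hb.getVert_injOn (x₁ := i) (x₂ := t.bypass.length) (by simp; omega) (by simp)
              (by rw [Walk.getVert_length]; exact hm)
            omega)
        have := Walk.length_bypass_le_length t
        refine ⟨q0.append q, ?_⟩
        simp [ht] at *
        omega
    · obtain ⟨q, hq⟩ := ih hv u hu (s.concat hadj) (by
        intro w hw hwB
        rw [Walk.support_concat, List.mem_append, List.mem_singleton] at hw
        rcases hw with hw | rfl
        · exact hs _ hw hwB
        · exact absurd hwB hx')
      exact ⟨q, by simp at hq ⊢; omega⟩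

theorem upper {V W : Type*} (H : SimpleGraph V) (Hs : SimpleGraph W) (B : Set V) (f : V → W)
    (hf : Function.Injective f)
    (Good : ∀ u v : V, Hs.Walk (f u) (f v) → Prop)
    (hrev : ∀ u v P, Good u v P → Good v u P.reverse)
    (hB : ∀ u v P, Good u v P → u ∈ B ∧ v ∈ B)
    (hlen : ∀ u v P, Good u v P → ∃ R : H.Walk u v, R.length ≤ P.length)
    (hint : ∀ u v P, Good u v P → ∀ i, 0 < i → i < P.length → P.getVert i ∉ f '' B)
    (hstep : ∀ u v P, Good u v P → ∀ i, 0 < i → i < P.length → ∀ y, Hs.Adj (P.getVert i) y →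
      y = P.getVert (i + 1) ∨ y = P.getVert (i - 1))
    (hedge : ∀ u ∈ B, ∀ b, Hs.Adj (f u) b → (∃ v ∈ B, b = f v ∧ H.Adj u v) ∨
      ∃ u' v' P, Good u' v' P ∧ s(f u, b) ∈ P.edges)
    {y z : W} (q : Hs.Walk y z) : ∀ v ∈ B, z = f v →
      (∀ u ∈ B, y = f u → ∃ R : H.Walk u v, R.length ≤ q.length ∧
        ∀ w ∈ B, f w ∈ q.support → w ∈ R.support) ∧
      (∀ u u' P, Good u u' P → ∀ i ≤ P.length, y = P.getVert i →
        (∃ R : H.Walk u v, R.length + i ≤ q.length ∧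
          ∀ w ∈ B, f w ∈ q.support → w ∈ R.support) ∨
        (∃ R : H.Walk u' v, R.length + (P.length - i) ≤ q.length ∧
          ∀ w ∈ B, f w ∈ q.support → w ∈ R.support)) := by
  -- it is enough to treat internal vertices in the second part
  have red : ∀ (y z : W) (q : Hs.Walk y z) (v : V),
      (∀ u ∈ B, y = f u → ∃ R : H.Walk u v, R.length ≤ q.length ∧
        ∀ w ∈ B, f w ∈ q.support → w ∈ R.support) →
      (∀ u u' P, Good u u' P → ∀ i, 0 < i → i < P.length → y = P.getVert i →
        (∃ R : H.Walk u v, R.length + i ≤ q.length ∧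
          ∀ w ∈ B, f w ∈ q.support → w ∈ R.support) ∨
        (∃ R : H.Walk u' v, R.length + (P.length - i) ≤ q.length ∧
          ∀ w ∈ B, f w ∈ q.support → w ∈ R.support)) →
      (∀ u u' P, Good u u' P → ∀ i ≤ P.length, y = P.getVert i →
        (∃ R : H.Walk u v, R.length + i ≤ q.length ∧
          ∀ w ∈ B, f w ∈ q.support → w ∈ R.support) ∨
        (∃ R : H.Walk u' v, R.length + (P.length - i) ≤ q.length ∧
          ∀ w ∈ B, f w ∈ q.support → w ∈ R.support)) := by
    intro y z q v hA hI u u' P hP i hi hy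
    rcases Nat.eq_zero_or_pos i with rfl | h0
    · left
      obtain ⟨R, h1, h2⟩ := hA u (hB _ _ _ hP).1 (by simpa using hy)
      exact ⟨R, by simpa using h1, h2⟩
    · rcases hi.eq_or_lt with rfl | hlt
      · right
        obtain ⟨R, h1, h2⟩ := hA u' (hB _ _ _ hP).2 (by simpa using hy)
        exact ⟨R, by simpa using h1, h2⟩
      · exact hI u u' P hP i h0 hlt hy
  induction q with
  | @nil y =>
    intro v hv hz
    have hA : ∀ u ∈ B, y = f u → ∃ R : H.Walk u v, R.length ≤ (Walk.nil : Hs.Walk y y).length ∧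
        ∀ w ∈ B, f w ∈ (Walk.nil : Hs.Walk y y).support → w ∈ R.support := by
      intro u hu hy
      obtain rfl : u = v := hf (hy.symm.trans hz)
      refine ⟨Walk.nil, by simp, ?_⟩
      intro w hw h
      simp at h
      simp [hf (h.trans hy)]
    refine ⟨hA, red _ _ _ _ hA ?_⟩
    intro u u' P hP i h0 hi hy
    exact absurd ⟨v, hv, hz.symm.trans hy⟩ (hint _ _ _ hP i h0 hi)
  | @cons y y' z hadj q ih =>
    intro v hv hz
    obtain ⟨ihA, ihB⟩ := ih v hv hz
    have hA : ∀ u ∈ B, y = f u → ∃ R : H.Walk u v, R.length ≤ (Walk.cons hadj q).length ∧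
        ∀ w ∈ B, f w ∈ (Walk.cons hadj q).support → w ∈ R.support := by
      intro u hu hy
      subst hy
      rcases hedge u hu y' hadj with ⟨u1, hu1, rfl, ha⟩ | ⟨a, b, P, hP, he⟩
      · obtain ⟨R, h1, h2⟩ := ihA u1 hu1 rfl
        refine ⟨Walk.cons ha R, by simpa using h1, ?_⟩
        intro w hw h
        rw [Walk.support_cons, List.mem_cons] at h ⊢
        rcases h with h | h
        · exact Or.inl (hf h)
        · exact Or.inr (h2 w hw h)
      · obtain ⟨u1, Q, hQ, hl, hy'⟩ : ∃ u1, ∃ Q : Hs.Walk (f u) (f u1), Good u u1 Q ∧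
            1 ≤ Q.length ∧ y' = Q.getVert 1 := by
          obtain ⟨i, hi, ⟨h1, h2⟩ | ⟨h1, h2⟩⟩ := edge_getVert P _ _ he
          · rcases Nat.eq_zero_or_pos i with rfl | h0
            · rw [Walk.getVert_zero] at h1
              obtain rfl := hf h1
              exact ⟨b, P, hP, by omega, h2⟩
            · exact absurd ⟨u, hu, h1⟩ (hint _ _ _ hP i h0 hi)
          · rcases (Nat.succ_le_of_lt hi).eq_or_lt with hh | hh
            · have hh' : i + 1 = P.length := hh
              rw [hh', Walk.getVert_length] at h1
              obtain rfl := hf h1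
              refine ⟨a, P.reverse, hrev _ _ _ hP, by simp; omega, ?_⟩
              rw [Walk.getVert_reverse, h2, ← hh']
              simp
            · exact absurd ⟨u, hu, h1⟩ (hint _ _ _ hP (i + 1) (by omega) hh)
        rcases ihB u u1 Q hQ 1 hl hy' with ⟨R, h1, h2⟩ | ⟨R, h1, h2⟩
        · refine ⟨R, by simp; omega, ?_⟩
          intro w hw h
          rw [Walk.support_cons, List.mem_cons] at h
          rcases h with h | h
          · rw [hf h]; simp
          · exact h2 w hw h
        · obtain ⟨S, hS⟩ := hlen _ _ _ hQ
          refine ⟨S.append R, by simp; omega, ?_⟩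
          intro w hw h
          rw [Walk.support_cons, List.mem_cons] at h
          rcases h with h | h
          · rw [hf h]; simp
          · rw [Walk.mem_support_append_iff]
            exact Or.inr (h2 w hw h)
    refine ⟨hA, red _ _ _ _ hA ?_⟩
    intro u u' P hP i h0 hi hy
    have hnB := hint _ _ _ hP i h0 hi
    rw [← hy] at hnB
    have hsup : ∀ w ∈ B, f w ∈ (Walk.cons hadj q).support → f w ∈ q.support := by
      intro w hw h
      rw [Walk.support_cons, List.mem_cons] at h
      rcases h with h | h
      · exact absurd ⟨w, hw, h⟩ hnB
      · exact h
    rcases hstep _ _ _ hP i h0 hi y' (hy ▸ hadj) with h | h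
    · rcases ihB u u' P hP (i + 1) (by omega) h with ⟨R, h1, h2⟩ | ⟨R, h1, h2⟩
      · exact Or.inl ⟨R, by simp; omega, fun w hw h => h2 w hw (hsup w hw h)⟩
      · exact Or.inr ⟨R, by simp; omega, fun w hw h => h2 w hw (hsup w hw h)⟩
    · rcases ihB u u' P hP (i - 1) (by omega) h with ⟨R, h1, h2⟩ | ⟨R, h1, h2⟩
      · exact Or.inl ⟨R, by simp; omega, fun w hw h => h2 w hw (hsup w hw h)⟩
      · exact Or.inr ⟨R, by simp; omega, fun w hw h => h2 w hw (hsup w hw h)⟩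

/-- In a path, an edge at the `i`-th vertex leads to a neighbouring index. -/
theorem path_step {V : Type*} {G : SimpleGraph V} {a b : V} (p : G.Walk a b) (hp : p.IsPath)
    (i : ℕ) (h0 : 0 < i) (hi : i < p.length) (y : V) (h : s(p.getVert i, y) ∈ p.edges) :
    y = p.getVert (i + 1) ∨ y = p.getVert (i - 1) := by
  obtain ⟨j, hj, ⟨h1, h2⟩ | ⟨h1, h2⟩⟩ := edge_getVert p _ _ h
  · have := hp.getVert_injOn (by simp; omega) (by simp; omega) h1
    subst this
    exact Or.inl h2
  · have := hp.getVert_injOn (by simp; omega) (by simp; omega) h1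
    subst this
    exact Or.inr (by simpa using h2)

end Stmt8

/-- `H` is a graph with `B ⊆ V(H)`; `Hs` (that is, `H*`) is a graph whose vertex
set consists of `B` (embedded via `Sum.inl`) together with new vertices `X`
(embedded via `Sum.inr`).  `I` is a set of unordered pairs of distinct vertices
of `B` which are connected in `H` and which contains every pair of distinct
vertices of `B` joined by a path of `H` with at least one internal vertex, all
of whose internal vertices avoid `B`.  Two vertices of `B` are adjacent in `H*`
iff they are adjacent in `H`, and for each pair in `I` there are paths `π`, `π'`
in `H*` of lengths `dist_H(u,v)` and `dist_H(u,v) + 1` with internal vertices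
outside `B`, pairwise internally disjoint; every vertex of `V(H*) \ B` lies on
one of these paths, and every edge of `H*` joins two vertices of `B` or is an
edge of one of these paths.  Then `dist_{H*}` and `dist_H` agree on `B`, and
every geodesic `R*` of `H*` between vertices of `B` yields a geodesic `R` of `H`
with the same endpoints satisfying `V(R*) ∩ B ⊆ V(R) ∩ B`. -/
theorem stmt8 {V X : Type*} [Fintype V] [Fintype X]
    (H : SimpleGraph V) (B : Set V)
    (Hs : SimpleGraph (V ⊕ X))
    (I : V → V → Prop) (hIsymm : Symmetric I)
    (hImem : ∀ u v : V, I u v → u ∈ B ∧ v ∈ B ∧ u ≠ v ∧ H.Reachable u v)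
    (hIpaths : ∀ u v : V, u ∈ B → v ∈ B → u ≠ v → ∀ p : H.Walk u v, p.IsPath →
      p.internals ≠ [] → (∀ w ∈ p.internals, w ∉ B) → I u v)
    (hadjB : ∀ u ∈ B, ∀ v ∈ B,
      (Hs.Adj (Sum.inl u) (Sum.inl v) ↔ H.Adj u v))
    (π π' : ∀ u v : V, I u v → Hs.Walk (Sum.inl u) (Sum.inl v))
    (hπ : ∀ (u v : V) (h : I u v), (π u v h).IsPath ∧
      (π u v h).length = H.dist u v ∧
      ∀ w ∈ (π u v h).internals, w ∉ Sum.inl '' B)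
    (hπ' : ∀ (u v : V) (h : I u v), (π' u v h).IsPath ∧
      (π' u v h).length = H.dist u v + 1 ∧
      ∀ w ∈ (π' u v h).internals, w ∉ Sum.inl '' B)
    (hrev : ∀ (u v : V) (h : I u v),
      π v u (hIsymm h) = (π u v h).reverse ∧ π' v u (hIsymm h) = (π' u v h).reverse)
    (hdisj1 : ∀ (u v : V) (h : I u v) (u' v' : V) (h' : I u' v'),
      (∀ w ∈ (π u v h).internals, w ∉ (π' u' v' h').support) ∧
      (∀ w ∈ (π' u v h).internals, w ∉ (π u' v' h').support))
    (hdisj2 : ∀ (u v : V) (h : I u v) (u' v' : V) (h' : I u' v'),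
      s(u, v) ≠ s(u', v') →
      (∀ w ∈ (π u v h).internals, w ∉ (π u' v' h').support) ∧
      (∀ w ∈ (π' u v h).internals, w ∉ (π' u' v' h').support))
    (hvert : ∀ x : X, ∃ (u v : V) (h : I u v),
      Sum.inr x ∈ (π u v h).internals ∨ Sum.inr x ∈ (π' u v h).internals)
    (hedge : ∀ a b : V ⊕ X, Hs.Adj a b →
      (∃ u ∈ B, ∃ v ∈ B, a = Sum.inl u ∧ b = Sum.inl v) ∨
      (∃ (u v : V) (h : I u v),
        s(a, b) ∈ (π u v h).edges ∨ s(a, b) ∈ (π' u v h).edges)) :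
    (∀ u ∈ B, ∀ v ∈ B, Hs.dist (Sum.inl u) (Sum.inl v) = H.dist u v) ∧
    (∀ u ∈ B, ∀ v ∈ B, ∀ Rs : Hs.Walk (Sum.inl u) (Sum.inl v),
      Hs.IsGeodesic Rs → ∃ R : H.Walk u v, H.IsGeodesic R ∧
        ∀ w ∈ B, Sum.inl w ∈ Rs.support → w ∈ R.support) := by
  classical
  set Good : ∀ u v : V, Hs.Walk (Sum.inl u) (Sum.inl v) → Prop :=
    fun u v P => ∃ h : I u v, P = π u v h ∨ P = π' u v h with hGood
  have gB : ∀ u v P, Good u v P → u ∈ B ∧ v ∈ B := by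
    rintro u v P ⟨h, -⟩
    exact ⟨(hImem u v h).1, (hImem u v h).2.1⟩
  have gint : ∀ u v P, Good u v P → ∀ i, 0 < i → i < P.length →
      P.getVert i ∉ Sum.inl '' B := by
    rintro u v P ⟨h, rfl | rfl⟩ i h0 hi
    · exact (hπ u v h).2.2 _ ((Stmt8.mem_internals _ _).2 ⟨i, h0, hi, rfl⟩)
    · exact (hπ' u v h).2.2 _ ((Stmt8.mem_internals _ _).2 ⟨i, h0, hi, rfl⟩)
  have up := @Stmt8.upper V (V ⊕ X) H Hs B Sum.inl Sum.inl_injective Good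
    (by
      rintro u v P ⟨h, rfl | rfl⟩
      · exact ⟨hIsymm h, Or.inl (hrev u v h).1.symm⟩
      · exact ⟨hIsymm h, Or.inr (hrev u v h).2.symm⟩)
    gB
    (by
      rintro u v P ⟨h, rfl | rfl⟩
      · obtain ⟨R, hR⟩ := (hImem u v h).2.2.2.exists_walk_length_eq_dist
        exact ⟨R, by rw [hR, (hπ u v h).2.1]⟩
      · obtain ⟨R, hR⟩ := (hImem u v h).2.2.2.exists_walk_length_eq_dist
        exact ⟨R, by rw [hR, (hπ' u v h).2.1]; omega⟩)
    gint
    (by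
      intro u v P hP i h0 hi y hadj
      have hnB := gint u v P hP i h0 hi
      rcases hedge _ _ hadj with ⟨a, ha, b, hb, h1, h2⟩ | ⟨a, b, hab, he⟩
      · exact absurd ⟨a, ha, h1.symm⟩ hnB
      · have hmem := (Stmt8.mem_internals P (P.getVert i)).2 ⟨i, h0, hi, rfl⟩
        have hpath : P.IsPath := by
          obtain ⟨h, rfl | rfl⟩ := hP
          · exact (hπ u v h).1
          · exact (hπ' u v h).1
        apply Stmt8.path_step P hpath i h0 hi
        obtain ⟨h, hP⟩ := hP
        have hsame : ∀ hne : s(u, v) = s(a, b), 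
            (π a b hab).edges.Perm (π u v h).edges ∧ (π' a b hab).edges.Perm (π' u v h).edges := by
          intro hne
          rcases Sym2.eq_iff.1 hne with ⟨rfl, rfl⟩ | ⟨rfl, rfl⟩
          · exact ⟨List.Perm.refl _, List.Perm.refl _⟩
          · rw [(hrev u v h).1, (hrev u v h).2]
            simp only [SimpleGraph.Walk.edges_reverse]
            exact ⟨List.reverse_perm _, List.reverse_perm _⟩
        rcases hP with rfl | rfl <;> rcases he with he | he
        · by_cases hne : s(u, v) = s(a, b)
          · exact (hsame hne).1.mem_iff.1 he
          · exact absurd (SimpleGraph.Walk.fst_mem_support_of_mem_edges _ he)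
              ((hdisj2 u v h a b hab hne).1 _ hmem)
        · exact absurd (SimpleGraph.Walk.fst_mem_support_of_mem_edges _ he)
              ((hdisj1 u v h a b hab).1 _ hmem)
        · exact absurd (SimpleGraph.Walk.fst_mem_support_of_mem_edges _ he)
              ((hdisj1 u v h a b hab).2 _ hmem)
        · by_cases hne : s(u, v) = s(a, b)
          · exact (hsame hne).2.mem_iff.1 he
          · exact absurd (SimpleGraph.Walk.fst_mem_support_of_mem_edges _ he)
              ((hdisj2 u v h a b hab hne).2 _ hmem))
    (by
      intro u hu b hadj
      rcases hedge _ _ hadj with ⟨a, ha, c, hc, h1, rfl⟩ | ⟨a, c, hac, he | he⟩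
      · exact Or.inl ⟨c, hc, rfl, (hadjB u hu c hc).1 hadj⟩
      · exact Or.inr ⟨a, c, _, ⟨hac, Or.inl rfl⟩, he⟩
      · exact Or.inr ⟨a, c, _, ⟨hac, Or.inr rfl⟩, he⟩)
  have up' : ∀ u ∈ B, ∀ v ∈ B, ∀ q : Hs.Walk (Sum.inl u) (Sum.inl v),
      ∃ R : H.Walk u v, R.length ≤ q.length ∧
        ∀ w ∈ B, Sum.inl w ∈ q.support → w ∈ R.support :=
    fun u hu v hv q => (up q v hv rfl).1 u hu rfl
  have low : ∀ u ∈ B, ∀ v ∈ B, ∀ p : H.Walk u v,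
      ∃ q : Hs.Walk (Sum.inl u) (Sum.inl v), q.length ≤ p.length := by
    intro u hu v hv p
    obtain ⟨q, hq⟩ := Stmt8.lower H Hs B Sum.inl (by
      intro u hu x hx hne s hs hin
      by_cases hnil : s.internals = []
      · have hl : s.length = 1 := by
          have h1 : s.length ≠ 0 := fun h => hne (SimpleGraph.Walk.eq_of_length_eq_zero h)
          have h2 : ¬ 1 < s.length := by
            intro h
            have := (Stmt8.mem_internals s _).2 ⟨1, by omega, h, rfl⟩
            rw [hnil] at this
            simp at this
          omega
        have hadj := SimpleGraph.Walk.adj_of_length_eq_one hl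
        exact ⟨((hadjB u hu x hx).2 hadj).toWalk, by simp [hl]⟩
      · have h := hIpaths u x hu hx hne s hs hnil hin
        exact ⟨π u x h, by rw [(hπ u x h).2.1]; exact SimpleGraph.dist_le s⟩)
      p hv u hu SimpleGraph.Walk.nil (by simp)
    exact ⟨q, by simpa using hq⟩
  have hdist : ∀ u ∈ B, ∀ v ∈ B, Hs.dist (Sum.inl u) (Sum.inl v) = H.dist u v := by
    intro u hu v hv
    by_cases hr : H.Reachable u v
    · obtain ⟨p, hp⟩ := hr.exists_walk_length_eq_dist
      obtain ⟨q, hq⟩ := low u hu v hv p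
      obtain ⟨q1, hq1⟩ := q.reachable.exists_walk_length_eq_dist
      obtain ⟨p1, hp1, -⟩ := up' u hu v hv q1
      have := SimpleGraph.dist_le q
      have := SimpleGraph.dist_le p1
      omega
    · have hr' : ¬ Hs.Reachable (Sum.inl u) (Sum.inl v) := by
        rintro ⟨q⟩
        obtain ⟨p, -⟩ := up' u hu v hv q
        exact hr p.reachable
      rw [SimpleGraph.dist_eq_zero_of_not_reachable hr,
        SimpleGraph.dist_eq_zero_of_not_reachable hr']
  refine ⟨hdist, ?_⟩
  rintro u hu v hv Rs ⟨-, hlen⟩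
  obtain ⟨R, hR, hsup⟩ := up' u hu v hv Rs
  have h1 := SimpleGraph.dist_le R
  have h2 := hdist u hu v hv
  have h3 : R.length = H.dist u v := by omega
  exact ⟨R, ⟨R.isPath_of_length_eq_dist h3, h3⟩, hsup⟩
end
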